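/- arXiv:2203.05500 — 3 statements merged into one kernel-verified Lean document; each statement's English description precedes it below -/
import Mathlib

section
/- Let p be a prime and G a finite group that contains a unique subgroup A of order p, and suppose A ⊆ Z(G). Then for every normalized 3-cocycle ω on G with values in ℂˣ and every a ∈ A, the 2-cocycle γ_a is a 2-coboundary of G; that is, A ⊆ Z_ω(G). -/
/-- Conjugation: `g^x = x⁻¹ * g * x`. -/
def cjg {G : Type*} [Group G] (g x : G) : G := x⁻¹ * g * x

/-- A normalized 3-cocycle on `G` with values in `ℂˣ`. -/
def IsNormalized3Cocycle {G : Type*} [Group G] (ω : G → G → G → ℂˣ) : Prop :=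
  (∀ x y z w, ω y z w * ω x (y * z) w * ω x y z = ω (x * y) z w * ω x y (z * w)) ∧
  (∀ x y z, (x = 1 ∨ y = 1 ∨ z = 1) → ω x y z = 1)

/-- `θ_g(x,y) = ω(g,x,y)·ω(x,y,g^{xy}) / ω(x,g^x,y)`. -/
def theta {G : Type*} [Group G] (ω : G → G → G → ℂˣ) (g x y : G) : ℂˣ :=
  ω g x y * ω x y (cjg g (x * y)) / ω x (cjg g x) y

/-- `γ_g(x,y) = ω(x,y,g)·ω(g,x^g,y^g) / ω(x,g,y^g)`. -/
def gam {G : Type*} [Group G] (ω : G → G → G → ℂˣ) (g x y : G) : ℂˣ :=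
  ω x y g * ω g (cjg x g) (cjg y g) / ω x g (cjg y g)

/-- A 2-coboundary of `G` with values in `ℂˣ`. -/
def Is2Coboundary {G : Type*} [Group G] (β : G → G → ℂˣ) : Prop :=
  ∃ f : G → ℂˣ, f 1 = 1 ∧ ∀ x y, β x y = f x * f y / f (x * y)

/-- A (normalized) 2-cocycle of `G` with values in `ℂˣ`. -/
def Is2Cocycle {G : Type*} [Group G] (β : G → G → ℂˣ) : Prop :=
  (∀ x, β x 1 = 1 ∧ β 1 x = 1) ∧
  (∀ x y z, β x y * β (x * y) z = β y z * β x (y * z))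

/-- An ω-admissible pair `(τ, ν)` for a subgroup `A`. -/
def IsAdmissiblePair {G : Type*} [Group G] (ω : G → G → G → ℂˣ) (A : Subgroup G)
    (τ : A → G → ℂˣ) (ν : A → (G →* ℂˣ)) : Prop :=
  (∀ x, τ 1 x = 1) ∧ (∀ a, τ a 1 = 1) ∧
  (∀ (a : A) (x y : G), theta ω (a : G) x y = τ a x * τ a y / τ a (x * y)) ∧
  (ν 1 = 1) ∧
  (∀ (a b : A) (g : G),
    theta ω g (a : G) (b : G) * (τ a g * τ b g / τ (a * b) g)
      = ν a g * ν b g / ν (a * b) g)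

theorem gam_central {G : Type*} [Group G] (ω : G → G → G → ℂˣ) {a : G}
    (ha : ∀ x, x * a = a * x) (x y : G) :
    gam ω a x y = ω x y a * ω a x y / ω x a y := by
  have h : ∀ x, cjg x a = x := fun x => by rw [cjg, mul_assoc, ha, inv_mul_cancel_left]
  rw [gam, h, h]

theorem is2Cocycle_gam {G : Type*} [Group G] {ω : G → G → G → ℂˣ}
    (hω : IsNormalized3Cocycle ω) {a : G} (ha : ∀ x, x * a = a * x) :
    Is2Cocycle (gam ω a) := by
  refine ⟨fun x => ?_, fun x y z => ?_⟩
  · simp [gam_central ω ha, hω.2]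
  · have h1 := congrArg Additive.ofMul (hω.1 a x y z)
    have h2 := congrArg Additive.ofMul (hω.1 x a y z)
    have h3 := congrArg Additive.ofMul (hω.1 x y a z)
    have h4 := congrArg Additive.ofMul (hω.1 x y z a)
    simp only [gam_central ω ha]
    apply Additive.ofMul.injective
    simp only [ha, ofMul_mul, ofMul_div] at *
    grind

theorem is2Coboundary_gam_mul {G : Type*} [Group G] {ω : G → G → G → ℂˣ}
    (hω : IsNormalized3Cocycle ω) {a b : G} (ha : ∀ x, x * a = a * x) (hb : ∀ x, x * b = b * x) :
    Is2Coboundary fun x y => gam ω a x y * gam ω b x y / gam ω (a * b) x y := by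
  have hab : ∀ x, x * (a * b) = a * b * x := fun x => by
    rw [← mul_assoc, ha, mul_assoc, hb, mul_assoc]
  refine ⟨fun x => (ω x a b * ω a b x / ω a x b)⁻¹, by simp [hω.2], fun x y => ?_⟩
  have h1 := congrArg Additive.ofMul (hω.1 x y a b)
  have h2 := congrArg Additive.ofMul (hω.1 x a y b)
  have h3 := congrArg Additive.ofMul (hω.1 x a b y)
  have h4 := congrArg Additive.ofMul (hω.1 a x y b)
  have h5 := congrArg Additive.ofMul (hω.1 a x b y)
  have h6 := congrArg Additive.ofMul (hω.1 a b x y)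
  simp only [gam_central ω ha, gam_central ω hb, gam_central ω hab]
  apply Additive.ofMul.injective
  simp only [ha x, ha y, hb x, hb y, ofMul_mul, ofMul_div, ofMul_inv] at *
  grind
/-- In a finite commutative `p`-group whose subgroups of order `p` coincide, every element is a
power of an element of maximal order. -/
theorem IsPGroup.isCyclic_of_unique {G : Type*} [CommGroup G] [Finite G] {p : ℕ} [Fact p.Prime]
    (hG : IsPGroup p G)
    (hU : ∀ x y : G, x ^ p = 1 → x ≠ 1 → y ^ p = 1 → y ∈ Subgroup.zpowers x) : IsCyclic G := by
  obtain ⟨h, hh⟩ := Monoid.exists_orderOf_eq_exponent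
    (Monoid.ExponentExists.of_finite (G := G))
  obtain ⟨k, hk⟩ := IsPGroup.iff_orderOf.1 hG h
  have hexp : ∀ x : G, x ^ p ^ k = 1 := fun x => by
    rw [← hk, hh, Monoid.pow_exponent_eq_one]
  have key : ∀ (i : ℕ) (x : G), x ^ p ^ i = 1 → x ∈ Subgroup.zpowers h := by
    intro i
    induction i with
    | zero => intro x hx; simp_all
    | succ i ih =>
      intro x hx
      obtain rfl | ⟨m, rfl⟩ : k = 0 ∨ ∃ m, k = m + 1 := by
        cases k <;> simp
      · have hx1 : x = 1 := by simpa using hexp x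
        exact hx1 ▸ one_mem _
      obtain ⟨j, hj⟩ := Subgroup.mem_zpowers_iff.1 (ih (x ^ p) (by rw [← pow_mul, ← pow_succ', hx]))
      have hj1 : h ^ (j * (p : ℤ) ^ m) = 1 := by
        rw [zpow_mul, hj]
        have := hexp x
        rw [pow_succ', pow_mul] at this
        exact_mod_cast this
      have hp0 : (p : ℤ) ^ m ≠ 0 := pow_ne_zero _ (by exact_mod_cast (Fact.out : p.Prime).ne_zero)
      rw [← orderOf_dvd_iff_zpow_eq_one, hk] at hj1
      push_cast at hj1
      rw [pow_succ', mul_dvd_mul_iff_right hp0] at hj1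
      obtain ⟨j', rfl⟩ := hj1
      have hy : (x * h ^ (-j')) ^ p = 1 := by
        rw [mul_pow, ← hj, ← zpow_natCast (h ^ _), ← zpow_mul, ← zpow_add]
        simp [mul_comm]
      have h0 : (h ^ p ^ m) ≠ 1 := by
        intro h0
        have := orderOf_dvd_of_pow_eq_one h0
        rw [hk, Nat.pow_dvd_pow_iff_le_right (Fact.out : p.Prime).one_lt] at this
        omega
      have := hU (h ^ p ^ m) _ (by rw [← pow_mul, ← pow_succ, ← hk, pow_orderOf_eq_one]) h0 hy
      have h2 := Subgroup.zpowers_le.2 (Subgroup.npow_mem_zpowers h (p ^ m)) this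
      have h3 := mul_mem h2 (Subgroup.zpow_mem_zpowers h j')
      simpa using h3
  refine ⟨h, fun x => ?_⟩
  obtain ⟨i, hi⟩ := hG x
  exact key i x hi

/-- A nontrivial normal subgroup of a `p`-group meets the center nontrivially. -/
theorem IsPGroup.exists_mem_normal_conj_eq {G : Type*} [Group G] [Finite G] {p : ℕ}
    [Fact p.Prime] (hG : IsPGroup p G) (C : Subgroup G) [C.Normal] [Nontrivial C] :
    ∃ b ∈ C, b ≠ 1 ∧ ∀ q, q * b * q⁻¹ = b := by
  obtain ⟨n, hn, hcard⟩ := (hG.to_subgroup C).nontrivial_iff_card.1 inferInstance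
  have hG' : IsPGroup p (ConjAct G) := hG.of_equiv ConjAct.toConjAct
  obtain ⟨b, hb, hb1⟩ := hG'.exists_fixed_point_of_prime_dvd_card_of_fixed_point
    C (hcard ▸ dvd_pow_self p hn.ne') (a := 1) (fun q => smul_one q)
  refine ⟨b, b.2, fun h => hb1 (Subtype.ext h.symm), fun q => ?_⟩
  have := congrArg Subtype.val (hb (ConjAct.toConjAct q))
  rwa [ConjAct.Subgroup.val_conj_smul, ConjAct.toConjAct_smul] at this

/-- A finite `p`-group has a commutative normal subgroup that contains its centralizer. -/
theorem IsPGroup.exists_normal_centralizer_le {G : Type*} [Group G] [Finite G] {p : ℕ}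
    [Fact p.Prime] (hG : IsPGroup p G) :
    ∃ N : Subgroup G, N.Normal ∧ (∀ x ∈ N, ∀ y ∈ N, x * y = y * x) ∧
      ∀ g, (∀ x ∈ N, g * x = x * g) → g ∈ N := by
  obtain ⟨N, ⟨hN, hNc⟩, hmax⟩ := Set.Finite.exists_maximal
    (s := {N : Subgroup G | N.Normal ∧ ∀ x ∈ N, ∀ y ∈ N, x * y = y * x}) (Set.toFinite _)
    ⟨⊥, inferInstance, by simp⟩
  refine ⟨N, hN, hNc, fun g hg => ?_⟩
  by_contra hgN
  obtain ⟨C, hCdef⟩ : ∃ C : Subgroup (G ⧸ N),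
    C = (Subgroup.centralizer (N : Set G)).map (QuotientGroup.mk' N) := ⟨_, rfl⟩
  have hC : C.Normal := hCdef ▸ Subgroup.Normal.map inferInstance _ (QuotientGroup.mk'_surjective N)
  have hgC : g ∈ Subgroup.centralizer (N : Set G) := by
    rw [Subgroup.mem_centralizer_iff]
    exact fun x hx => (hg x hx).symm
  have hnt : Nontrivial C := by
    refine ⟨⟨⟨QuotientGroup.mk' N g, hCdef ▸ Subgroup.mem_map_of_mem _ hgC⟩, 1, fun h => hgN ?_⟩⟩
    have := congrArg Subtype.val h
    simpa using this
  have hQ : IsPGroup p (G ⧸ N) := hG.to_quotient N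
  obtain ⟨b, hbC, hb1, hb⟩ := hQ.exists_mem_normal_conj_eq C
  obtain ⟨x, hx, rfl⟩ := Subgroup.mem_map.1 (hCdef ▸ hbC)
  have hxcen : ∀ q : G ⧸ N, q * (x : G ⧸ N) * q⁻¹ = x := hb
  have hxN : x ∉ N := by
    exact fun h => hb1 ((QuotientGroup.eq_one_iff x).2 h)
  let M : Subgroup G := (Subgroup.zpowers (x : G ⧸ N)).comap (QuotientGroup.mk' N)
  have hM : ∀ m ∈ M, ∃ (i : ℤ), ∃ y ∈ N, m = x ^ i * y := by
    intro m hm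
    obtain ⟨i, hi⟩ := Subgroup.mem_zpowers_iff.1 (Subgroup.mem_comap.1 hm)
    refine ⟨i, (x ^ i)⁻¹ * m, ?_, by group⟩
    rw [← QuotientGroup.eq]
    exact hi
  have hxc : ∀ (i : ℤ), ∀ y ∈ N, Commute (x ^ i) y := fun i y hy =>
    Commute.zpow_left (Subgroup.mem_centralizer_iff.1 hx y hy).symm i
  have hMmem : M ∈ {N : Subgroup G | N.Normal ∧ ∀ x ∈ N, ∀ y ∈ N, x * y = y * x} := by
    refine ⟨Subgroup.Normal.comap ⟨?_⟩ _, ?_⟩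
    · intro n hn q
      obtain ⟨i, rfl⟩ := Subgroup.mem_zpowers_iff.1 hn
      rw [← conj_zpow, hxcen]
      exact Subgroup.zpow_mem_zpowers _ i
    · intro a ha b hb
      obtain ⟨i, y, hy, rfl⟩ := hM a ha
      obtain ⟨j, z, hz, rfl⟩ := hM b hb
      exact ((((Commute.refl x).zpow_zpow i j).mul_right (hxc i z hz)).mul_left
        ((hxc j y hy).symm.mul_right (hNc y hy z hz)))
  refine hxN (hmax hMmem ?_ ?_)
  · intro y hy
    have : (y : G ⧸ N) = 1 := (QuotientGroup.eq_one_iff y).2 hy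
    change (y : G ⧸ N) ∈ Subgroup.zpowers (x : G ⧸ N)
    rw [this]
    exact one_mem _
  · exact Subgroup.mem_zpowers (x : G ⧸ N)

theorem IsCyclic.mulAutMulEquiv_symm_eq_pow {G : Type*} [Group G] [Finite G] [IsCyclic G]
    (v : (ZMod (Nat.card G))ˣ) (x : G) :
    (IsCyclic.mulAutMulEquiv G).symm v x = x ^ (v : ZMod (Nat.card G)).val := by
  have : NeZero (Nat.card G) := ⟨Nat.card_pos.ne'⟩
  obtain ⟨y, rfl⟩ := (zmodCyclicMulEquiv (G := G) inferInstance).surjective x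
  rw [IsCyclic.mulAutMulEquiv_symm_apply_apply, MulEquiv.symm_apply_apply, ← map_pow]
  congr 1
  apply Multiplicative.toAdd.injective
  change (v : ZMod (Nat.card G)) * y.toAdd = (v : ZMod (Nat.card G)).val • y.toAdd
  rw [nsmul_eq_mul, ZMod.natCast_zmod_val]

/-- In a finite 2-group with at most one involution, an element `g` whose square lies in a
self-centralizing cyclic subgroup `⟨h⟩` and which fixes `⟨h⟩` modulo 4 lies in `⟨h⟩`. -/
theorem mem_zpowers_of_conj_eq_pow {G : Type*} [Group G]
    (hU : ∀ x y : G, x ^ 2 = 1 → x ≠ 1 → y ^ 2 = 1 → y ∈ Subgroup.zpowers x)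
    {g h : G} {k s : ℕ} (hk : h ^ 2 ^ k = 1) (hgh : g * h * g⁻¹ = h ^ (1 + 4 * s))
    (hg : g ^ 2 ∈ Subgroup.zpowers h)
    (hc : Commute g h → g ∈ Subgroup.zpowers h) : g ∈ Subgroup.zpowers h := by
  obtain ⟨j, hj⟩ := Subgroup.mem_zpowers_iff.1 hg
  have hconj : ∀ i : ℤ, g * h ^ i * g⁻¹ = h ^ i * h ^ (4 * s * i) := by
    intro i
    rw [← conj_zpow, hgh, ← zpow_natCast, ← zpow_mul, ← zpow_add]
    congr 1; push_cast; ring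
  have h8 : h ^ (8 * s) = 1 := by
    have e1 : (h ^ (8 * s)) ^ (1 + 2 * s) = 1 := by
      have e : g * (g * h * g⁻¹) * g⁻¹ = h := by
        calc g * (g * h * g⁻¹) * g⁻¹ = g ^ 2 * h * (g ^ 2)⁻¹ := by rw [pow_two]; group
          _ = h := by rw [← hj]; group
      rw [hgh, ← conj_pow, hgh, ← pow_mul] at e
      have : h * (h ^ (8 * s)) ^ (1 + 2 * s) = h * 1 := by
        conv_rhs => rw [mul_one, ← e]
        rw [← pow_mul, ← pow_succ']
        congr 1; ring
      exact mul_left_cancel this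
    have e2 : (h ^ (8 * s)) ^ 2 ^ k = 1 := by rw [← pow_mul, mul_comm, pow_mul, hk, one_pow]
    have hcop : Nat.Coprime (1 + 2 * s) (2 ^ k) :=
      Nat.Coprime.pow_right _ (by simp)
    exact (pow_eq_one_iff_of_coprime (hcop)).1 ⟨e1, e2⟩
  set c : G := h ^ (4 * s) with hcdef
  have hcc : c ^ 2 = 1 := by rw [hcdef, ← pow_mul, ← h8]; congr 1; ring
  have hgc : ∀ i : ℤ, g * h ^ i * g⁻¹ = h ^ i * c ^ i := by
    intro i
    rw [hconj, hcdef, ← zpow_natCast, ← zpow_mul]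
    push_cast; rfl
  have hc_mem : c ∈ Subgroup.zpowers h := Subgroup.npow_mem_zpowers h _
  obtain hc1 | hc1 := eq_or_ne c 1
  · refine hc ?_
    have := hgc 1
    rw [hc1] at this
    simpa [mul_inv_eq_iff_eq_mul, commute_iff_eq] using this
  have hinv : ∀ t : G, t ^ 2 = 1 → t ∈ Subgroup.zpowers h := fun t ht =>
    Subgroup.zpowers_le.2 hc_mem (hU c t hcc hc1 ht)
  have hcj : c ^ j = 1 := by
    have := hgc j
    rw [hj] at this
    simpa [pow_two, mul_assoc] using this
  obtain ⟨m, rfl⟩ : (2 : ℤ) ∣ j := by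
    have h2 : orderOf c = 2 := orderOf_eq_prime hcc hc1
    rw [← orderOf_dvd_iff_zpow_eq_one, h2] at hcj
    exact_mod_cast hcj
  have hcm : Commute c h := (Commute.refl h).pow_left _
  have ht : (g * h ^ (-m)) ^ 2 = c ^ (-m) := by
    calc (g * h ^ (-m)) ^ 2 = (g * h ^ (-m) * g⁻¹) * g ^ 2 * h ^ (-m) := by
          rw [pow_two, pow_two]; group
      _ = c ^ (-m) * h ^ (-m) * h ^ (2 * m) * h ^ (-m) := by
          rw [hgc, hj, ((hcm.zpow_zpow (-m) (-m)).eq)]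
      _ = c ^ (-m) := by
          rw [mul_assoc, mul_assoc, ← zpow_add, ← zpow_add]
          simp [two_mul]
  have hfin : ∀ i : ℤ, g * h ^ i ∈ Subgroup.zpowers h → g ∈ Subgroup.zpowers h := fun i hi =>
    (Subgroup.mul_mem_cancel_right _ (Subgroup.zpow_mem_zpowers h i)).1 hi
  obtain ⟨r, hr⟩ | ⟨r, hr⟩ := Int.even_or_odd (-m)
  · refine hfin (-m) (hinv _ ?_)
    rw [ht, hr, ← two_mul, zpow_mul]
    simp [show c ^ (2 : ℤ) = 1 from mod_cast hcc]
  · have hcm1 : c ^ (-m) = c := by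
      rw [hr, zpow_add, zpow_mul]
      simp [show c ^ (2 : ℤ) = 1 from mod_cast hcc]
    have hgu : Commute g (h ^ (2 * s : ℤ)) := by
      have h1 := hgc (2 * s)
      rw [zpow_mul c, show c ^ (2 : ℤ) = 1 from mod_cast hcc, one_zpow, mul_one,
        mul_inv_eq_iff_eq_mul] at h1
      exact h1
    refine hfin (-m + 2 * s) (hinv _ ?_)
    rw [zpow_add, ← mul_assoc, (hgu.mul_left ((Commute.refl h).zpow_zpow _ _)).mul_pow, ht, hcm1]
    have : (h ^ (2 * s : ℤ)) ^ 2 = c := by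
      rw [hcdef, ← zpow_natCast, ← zpow_natCast, ← zpow_mul]
      congr 1; push_cast; ring
    rw [this, ← pow_two, hcc]

/-- In a finite `p`-group whose subgroups of order `p` coincide, commutative subgroups are cyclic. -/
theorem IsPGroup.isCyclic_subgroup_of_unique {G : Type*} [Group G] [Finite G] {p : ℕ}
    [Fact p.Prime] (hG : IsPGroup p G)
    (hU : ∀ x y : G, x ^ p = 1 → x ≠ 1 → y ^ p = 1 → y ∈ Subgroup.zpowers x)
    (N : Subgroup G) (hN : ∀ x ∈ N, ∀ y ∈ N, x * y = y * x) : IsCyclic N := by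
  let _ : CommGroup N := { mul_comm := fun x y => Subtype.ext (hN x x.2 y y.2) }
  refine (hG.to_subgroup N).isCyclic_of_unique fun x y hx hx1 hy => ?_
  obtain ⟨i, hi⟩ := Subgroup.mem_zpowers_iff.1 (hU x y (by exact_mod_cast hx)
    (by exact_mod_cast hx1) (by exact_mod_cast hy))
  exact ⟨i, Subtype.ext (by simpa using hi)⟩

theorem exists_zpow_mul_mem_ker {G U : Type*} [Group G] [Group U] [IsCyclic U] (f : G →* U) :
    ∃ g, ∀ x, ∃ i : ℤ, x * g ^ i ∈ f.ker := by
  obtain ⟨⟨_, g, rfl⟩, hg⟩ := IsCyclic.exists_generator (α := f.range)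
  refine ⟨g, fun x => ?_⟩
  obtain ⟨i, hi⟩ := Subgroup.mem_zpowers_iff.1 (hg ⟨f x, x, rfl⟩)
  have hi' : f g ^ i = f x := congrArg Subtype.val hi
  exact ⟨-i, by rw [MonoidHom.mem_ker, map_mul, map_zpow, ← hi', zpow_neg, mul_inv_cancel]⟩

/-- A finite `p`-group whose subgroups of order `p` coincide is abelian-by-cyclic. -/
theorem IsPGroup.exists_normal_zpow_mul_mem {G : Type*} [Group G] [Finite G] {p : ℕ}
    [hp : Fact p.Prime] (hG : IsPGroup p G)
    (hU : ∀ x y : G, x ^ p = 1 → x ≠ 1 → y ^ p = 1 → y ∈ Subgroup.zpowers x) :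
    ∃ N : Subgroup G, N.Normal ∧ (∀ x ∈ N, ∀ y ∈ N, x * y = y * x) ∧
      ∃ g, ∀ x, ∃ i : ℤ, x * g ^ i ∈ N := by
  obtain ⟨N, hN, hNc, hcen⟩ := hG.exists_normal_centralizer_le
  refine ⟨N, hN, hNc, ?_⟩
  have hcyc : IsCyclic N := hG.isCyclic_subgroup_of_unique hU N hNc
  obtain ⟨k, hk⟩ := IsPGroup.iff_card.1 (hG.to_subgroup N)
  let f : G →* (ZMod (Nat.card N))ˣ :=
    (IsCyclic.mulAutMulEquiv N).toMonoidHom.comp MulAut.conjNormal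
  have hf : ∀ (x : G) (y : N), x * y * x⁻¹ = (y : G) ^ (f x : ZMod (Nat.card N)).val := by
    intro x y
    rw [← MulAut.conjNormal_apply, ← SubgroupClass.coe_pow,
      ← IsCyclic.mulAutMulEquiv_symm_eq_pow]
    simp [f]
  have hfN : ∀ x ∈ N, f x = 1 := by
    intro x hx
    have : (MulAut.conjNormal x : MulAut N) = 1 := by
      ext y
      rw [MulAut.conjNormal_apply, hNc x hx y y.2, mul_inv_cancel_right]
      rfl
    simp [f, this]
  have hker : f.ker ≤ N := by
    intro x hx
    refine hcen x fun y hy => ?_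
    have h1 : (MulAut.conjNormal x : MulAut N) = 1 := by
      simpa [f] using hx
    have := MulAut.conjNormal_apply x (⟨y, hy⟩ : N)
    rw [h1] at this
    exact (eq_mul_inv_iff_mul_eq.1 this).symm
  suffices ∃ (U : Type) (_ : Group U) (_ : IsCyclic U) (F : G →* U), F.ker ≤ N by
    obtain ⟨U, _, _, F, hF⟩ := this
    obtain ⟨g, hg⟩ := exists_zpow_mul_mem_ker F
    exact ⟨g, fun x => (hg x).imp fun i hi => hF hi⟩
  by_cases h4 : IsCyclic (ZMod (Nat.card N))ˣ
  · exact ⟨_, _, h4, f, hker⟩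
  obtain rfl : p = 2 := by
    by_contra hp2
    refine h4 ((ZMod.isCyclic_units_iff _).2 ?_)
    rw [hk]
    rcases Nat.eq_zero_or_pos k with rfl | hk0
    · simp
    · exact Or.inr (Or.inr (Or.inr (Or.inr ⟨p, k, hp.out, hp.out.odd_of_ne_two hp2, hk0, .inl rfl⟩)))
  have hdvd : 4 ∣ Nat.card N := by
    rw [hk]
    have : 2 ≤ k := by
      by_contra! hk2
      refine h4 ((ZMod.isCyclic_units_iff _).2 ?_)
      rw [hk]
      interval_cases k <;> simp
    exact pow_dvd_pow 2 this
  have hcyc4 : IsCyclic (ZMod 4)ˣ := (ZMod.isCyclic_units_iff 4).2 (by simp)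
  refine ⟨_, _, hcyc4, (ZMod.unitsMap hdvd).comp f, ?_⟩
  obtain ⟨h, hh⟩ := hcyc.exists_generator
  have hzp : Subgroup.zpowers (h : G) = N := by
    refine le_antisymm (Subgroup.zpowers_le.2 h.2) fun y hy => ?_
    obtain ⟨i, hi⟩ := Subgroup.mem_zpowers_iff.1 (hh ⟨y, hy⟩)
    exact ⟨i, by simpa using congrArg Subtype.val hi⟩
  have hhk : (h : G) ^ 2 ^ k = 1 := by
    rw [← hk, ← SubgroupClass.coe_pow, pow_card_eq_one', OneMemClass.coe_one]
  have hsq : ∀ g, ((ZMod.unitsMap hdvd).comp f) g = 1 → g ^ 2 ∈ N → g ∈ N := by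
    intro g hg hg2
    have : NeZero (Nat.card N) := ⟨Nat.card_pos.ne'⟩
    have hval : (f g : ZMod (Nat.card N)).val % 4 = 1 := by
      have h1 := congrArg Units.val hg
      rw [MonoidHom.comp_apply, ZMod.unitsMap_def, Units.coe_map] at h1
      have h2 : (((f g : ZMod (Nat.card N)).val : ℕ) : ZMod 4) = ((1 : ℕ) : ZMod 4) := by
        rw [Nat.cast_one, ← Units.val_one, ← h1]
        simp [ZMod.castHom_apply, ZMod.natCast_val]
      exact (ZMod.natCast_eq_natCast_iff' _ _ 4).1 h2
    rw [← hzp]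
    refine mem_zpowers_of_conj_eq_pow hU (s := (f g : ZMod (Nat.card N)).val / 4) hhk ?_
      (by rwa [hzp]) fun hgh => ?_
    · rw [hf g h]
      congr 1; omega
    · rw [hzp]
      refine hcen g fun y hy => ?_
      rw [← hzp] at hy
      obtain ⟨i, rfl⟩ := Subgroup.mem_zpowers_iff.1 hy
      exact hgh.zpow_right i
  have hpow : ∀ (i : ℕ) g, ((ZMod.unitsMap hdvd).comp f) g = 1 → g ^ 2 ^ i ∈ N → g ∈ N := by
    intro i
    induction i with
    | zero => intro g _ h; simpa using h
    | succ i ih =>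
      intro g hg hgi
      refine hsq g hg (ih (g ^ 2) (by rw [map_pow, hg, one_pow]) ?_)
      rwa [← pow_mul, ← pow_succ']
  intro g hg
  obtain ⟨i, hi⟩ := hG g
  exact hpow i g hg (by rw [hi]; exact one_mem N)

/-- If `E` is a central extension of an abelian-by-cyclic group in which commuting elements have
commuting lifts, then the kernel of the extension meets the commutator subgroup trivially. -/
theorem eq_one_of_mem_ker_of_mem_commutator {E P : Type*} [Group E] [Group P] (π : E →* P)
    (hπ : Function.Surjective π) (hcomm : ∀ x y : E, Commute (π x) (π y) → Commute x y)
    (N : Subgroup P) [N.Normal] (hN : ∀ x ∈ N, ∀ y ∈ N, x * y = y * x) (g : P)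
    (hg : ∀ x, ∃ i : ℤ, x * g ^ i ∈ N) {z : E} (hz : π z = 1) (hzE : z ∈ commutator E) :
    z = 1 := by
  obtain ⟨t, rfl⟩ := hπ g
  let M : Subgroup E := N.comap π
  have hM : ∀ x ∈ M, ∀ y ∈ M, x * y = y * x := fun x hx y hy =>
    hcomm x y (hN _ hx _ hy)
  have hMt : ∀ x ∈ M, t * x * t⁻¹ ∈ M := fun x hx =>
    (inferInstance : M.Normal).conj_mem x hx t
  have hdec : ∀ x, ∃ m ∈ M, ∃ i : ℤ, x = m * t ^ i := fun x => by
    obtain ⟨i, hi⟩ := hg (π x)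
    exact ⟨x * t ^ i, by simpa [M] using hi, -i, by simp⟩
  let K : Subgroup E :=
    { carrier := {x | ∃ m ∈ M, x = m * (t * m * t⁻¹)⁻¹}
      one_mem' := ⟨1, one_mem M, by simp⟩
      mul_mem' := by
        rintro _ _ ⟨m, hm, rfl⟩ ⟨n, hn, rfl⟩
        refine ⟨m * n, mul_mem hm hn, ?_⟩
        have e1 := hM (t * m * t⁻¹)⁻¹ (inv_mem (hMt m hm)) _ (mul_mem hn (inv_mem (hMt n hn)))
        calc m * (t * m * t⁻¹)⁻¹ * (n * (t * n * t⁻¹)⁻¹)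
            = m * ((t * m * t⁻¹)⁻¹ * (n * (t * n * t⁻¹)⁻¹)) := by group
          _ = _ := by rw [e1]; group
      inv_mem' := by
        rintro _ ⟨m, hm, rfl⟩
        refine ⟨m⁻¹, inv_mem hm, ?_⟩
        have e1 := hM m⁻¹ (inv_mem hm) _ (hMt m hm)
        calc (m * (t * m * t⁻¹)⁻¹)⁻¹ = (t * m * t⁻¹) * m⁻¹ := by group
          _ = _ := by rw [← e1]; group }
  have hKM : K ≤ M := by
    rintro _ ⟨m, hm, rfl⟩
    exact mul_mem hm (inv_mem (hMt m hm))
  have hKt : ∀ x ∈ K, ∀ i : ℤ, t ^ i * x * (t ^ i)⁻¹ ∈ K := by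
    rintro _ ⟨m, hm, rfl⟩ i
    refine ⟨t ^ i * m * (t ^ i)⁻¹, (inferInstance : M.Normal).conj_mem m hm _, ?_⟩
    have : t ^ i * t = t * t ^ i := by rw [← zpow_add_one, ← zpow_one_add, add_comm]
    have h2 : t * (t ^ i * m * (t ^ i)⁻¹) * t⁻¹ = t ^ i * (t * m * t⁻¹) * (t ^ i)⁻¹ := by
      calc _ = (t * t ^ i) * m * (t * t ^ i)⁻¹ := by group
        _ = _ := by rw [← this]; group
    rw [h2]
    group
  have hK : K.Normal := by
    refine ⟨fun x hx y => ?_⟩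
    obtain ⟨m, hm, i, rfl⟩ := hdec y
    have h1 := hKt x hx i
    have h2 := hM m hm _ (hKM h1)
    have : m * t ^ i * x * (m * t ^ i)⁻¹ = m * (t ^ i * x * (t ^ i)⁻¹) * m⁻¹ := by group
    rw [this, h2, mul_inv_cancel_right]
    exact h1
  have hmt : ∀ m ∈ M, Commute (m : E ⧸ K) (t : E ⧸ K) := by
    intro m hm
    have : ((m * (t * m * t⁻¹)⁻¹ : E) : E ⧸ K) = 1 := (QuotientGroup.eq_one_iff _).2 ⟨m, hm, rfl⟩
    have h2 : (m : E ⧸ K) = t * m * (t : E ⧸ K)⁻¹ := mul_inv_eq_one.1 this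
    exact eq_mul_inv_iff_mul_eq.1 h2
  have hab : ∀ x y : E ⧸ K, x * y = y * x := by
    intro x y
    obtain ⟨x, rfl⟩ := QuotientGroup.mk_surjective x
    obtain ⟨y, rfl⟩ := QuotientGroup.mk_surjective y
    obtain ⟨m, hm, i, rfl⟩ := hdec x
    obtain ⟨n, hn, j, rfl⟩ := hdec y
    have hmn : Commute (m : E ⧸ K) (n : E ⧸ K) :=
      congrArg (QuotientGroup.mk (s := K)) (hM m hm n hn)
    change Commute ((m : E ⧸ K) * (t : E ⧸ K) ^ i) ((n : E ⧸ K) * (t : E ⧸ K) ^ j)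
    exact (hmn.mul_right ((hmt m hm).zpow_right j)).mul_left
      (((hmt n hn).symm.zpow_left i).mul_right ((Commute.refl _).zpow_zpow i j))
  have hzK : z ∈ K := by
    have : commutator E ≤ K := by
      rw [commutator_def, Subgroup.commutator_le]
      intro x _ y _
      rw [← QuotientGroup.ker_mk' K, MonoidHom.mem_ker, map_commutatorElement,
        commutatorElement_eq_one_iff_mul_comm]
      exact hab _ _
    exact this hzE
  obtain ⟨m, hm, rfl⟩ := hzK
  have : Commute (π m) (π t) := by
    rw [map_mul, map_inv, mul_inv_eq_one, map_mul, map_mul, map_inv] at hz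
    exact eq_mul_inv_iff_mul_eq.1 hz
  rw [mul_inv_eq_one, eq_mul_inv_iff_mul_eq]
  exact hcomm _ _ this

/-- A homomorphism to `ℂˣ` on the kernel of a central extension extends to the whole group when
the kernel meets the commutator subgroup trivially. -/
theorem exists_monoidHom_units_complex_retraction {E : Type*} [Group E] (ι : ℂˣ →* E)
    (hι : ∀ z, ι z ∈ commutator E → z = 1) : ∃ χ : E →* ℂˣ, ∀ z, χ (ι z) = z := by
  have hroot : ∀ {n : ℤ}, n ≠ 0 → Function.Surjective fun a : Additive ℂˣ => n • a := by
    intro n hn a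
    have hnat : ∃ b : ℂˣ, b ^ n.natAbs = a.toMul := by
      obtain ⟨b, hb⟩ := IsAlgClosed.exists_pow_nat_eq (a.toMul : ℂ) (Int.natAbs_pos.2 hn)
      have hb0 : b ≠ 0 := by
        rintro rfl
        rw [zero_pow (Int.natAbs_ne_zero.2 hn)] at hb
        exact a.toMul.ne_zero hb.symm
      exact ⟨Units.mk0 b hb0, Units.ext (by simpa using hb)⟩
    obtain ⟨b, hb⟩ := hnat
    obtain h | h := Int.natAbs_eq n
    · refine ⟨.ofMul b, ?_⟩
      apply Additive.toMul.injective
      change b ^ n = _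
      rw [h, zpow_natCast, hb]
    · refine ⟨.ofMul b⁻¹, ?_⟩
      apply Additive.toMul.injective
      change b⁻¹ ^ n = _
      rw [h, inv_zpow, zpow_neg, inv_inv, zpow_natCast, hb]
  have : DivisibleBy (Additive ℂˣ) ℤ := divisibleByOfSMulRightSurj _ _ hroot
  have hinj : Function.Injective (MonoidHom.toAdditive (Abelianization.of.comp ι)) := by
    rw [injective_iff_map_eq_zero]
    intro a ha
    refine hι a.toMul ?_
    rw [← Abelianization.ker_of]
    exact ha
  obtain ⟨h, hh⟩ := (Module.Baer.of_divisible (Additive ℂˣ)).extension_property_addMonoidHom _ hinj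
    (AddMonoidHom.id _)
  exact ⟨(MonoidHom.toAdditive.symm h).comp Abelianization.of,
    fun z => DFunLike.congr_fun hh (Additive.ofMul z)⟩

/-- The central extension of `G` by `ℂˣ` defined by a 2-cocycle. -/
@[ext]
structure CocycleExt {G : Type*} [Group G] {β : G → G → ℂˣ} (hβ : Is2Cocycle β) where
  /-- The central coordinate. -/
  fst : ℂˣ
  /-- The projection to `G`. -/
  snd : G

namespace CocycleExt

variable {G : Type*} [Group G] {β : G → G → ℂˣ} (hβ : Is2Cocycle β)

instance : Mul (CocycleExt hβ) := ⟨fun x y => ⟨x.fst * y.fst * β x.snd y.snd, x.snd * y.snd⟩⟩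

instance : One (CocycleExt hβ) := ⟨⟨1, 1⟩⟩

instance : Inv (CocycleExt hβ) := ⟨fun x => ⟨x.fst⁻¹ * (β x.snd⁻¹ x.snd)⁻¹, x.snd⁻¹⟩⟩

theorem mul_def (x y : CocycleExt hβ) :
    x * y = ⟨x.fst * y.fst * β x.snd y.snd, x.snd * y.snd⟩ := rfl

theorem one_def : (1 : CocycleExt hβ) = ⟨1, 1⟩ := rfl

theorem inv_def (x : CocycleExt hβ) :
    x⁻¹ = ⟨x.fst⁻¹ * (β x.snd⁻¹ x.snd)⁻¹, x.snd⁻¹⟩ := rfl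

instance : Group (CocycleExt hβ) :=
  Group.ofLeftAxioms
    (fun x y z => by
      ext1
      · simp only [mul_def]
        have := hβ.2 x.snd y.snd z.snd
        calc _ = x.fst * y.fst * z.fst * (β x.snd y.snd * β (x.snd * y.snd) z.snd) := by
              ac_rfl
          _ = _ := by rw [this]; ac_rfl
      · exact mul_assoc _ _ _)
    (fun x => by simp [mul_def, one_def, (hβ.1 _).2])
    (fun x => by simp [mul_def, one_def, inv_def])

/-- The projection of the extension to `G`. -/
def proj : CocycleExt hβ →* G where
  toFun := snd
  map_one' := rfl
  map_mul' _ _ := rfl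

/-- The inclusion of `ℂˣ` in the extension. -/
def incl : ℂˣ →* CocycleExt hβ where
  toFun z := ⟨z, 1⟩
  map_one' := rfl
  map_mul' z w := by simp [mul_def, (hβ.1 _).2]

theorem proj_surjective : Function.Surjective (proj hβ) := fun g => ⟨⟨1, g⟩, rfl⟩

theorem commute_incl (z : ℂˣ) (x : CocycleExt hβ) : Commute (incl hβ z) x := by
  ext1
  · simp [incl, mul_def, hβ.1, mul_comm]
  · simp [incl, mul_def]

theorem incl_mul_mk (g h : G) :
    (⟨1, g⟩ : CocycleExt hβ) * ⟨1, h⟩ = incl hβ (β g h) * ⟨1, g * h⟩ := by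
  ext1 <;> simp [incl, mul_def, hβ.1]

theorem eq_incl_of_proj_eq_one {x : CocycleExt hβ} (hx : proj hβ x = 1) :
    x = incl hβ x.fst :=
  CocycleExt.ext rfl hx

/-- A character of the extension that is the `n`-th power map on `ℂˣ` trivializes `β ^ n`. -/
theorem is2Coboundary_pow (χ : CocycleExt hβ →* ℂˣ) (n : ℕ) (hχ : ∀ z, χ (incl hβ z) = z ^ n) :
    Is2Coboundary fun x y => β x y ^ n := by
  refine ⟨fun g => χ ⟨1, g⟩, map_one χ, fun x y => ?_⟩
  rw [← map_mul, incl_mul_mk, map_mul, hχ, mul_div_cancel_right]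

theorem commute_of_proj_mem_zpowers {x y : CocycleExt hβ} {c : G}
    (hx : proj hβ x ∈ Subgroup.zpowers c) (hy : proj hβ y ∈ Subgroup.zpowers c) :
    Commute x y := by
  obtain ⟨c, rfl⟩ := proj_surjective hβ c
  have key : ∀ x, proj hβ x ∈ Subgroup.zpowers (proj hβ c) →
      ∃ z, ∃ i : ℤ, x = incl hβ z * c ^ i := by
    intro x hx
    obtain ⟨i, hi⟩ := Subgroup.mem_zpowers_iff.1 hx
    refine ⟨_, i, eq_mul_of_mul_inv_eq (eq_incl_of_proj_eq_one hβ ?_)⟩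
    rw [map_mul, map_inv, map_zpow, hi, mul_inv_cancel]
  obtain ⟨z, i, rfl⟩ := key x hx
  obtain ⟨w, j, rfl⟩ := key y hy
  exact (commute_incl hβ z _).mul_left
    ((commute_incl hβ w _).symm.mul_right ((Commute.refl c).zpow_zpow i j))

end CocycleExt

/-- The Schur multiplier of a `p`-group whose subgroups of order `p` coincide is trivial. -/
theorem IsPGroup.is2Coboundary_of_unique {G : Type*} [Group G] [Finite G] {p : ℕ}
    [Fact p.Prime] (hG : IsPGroup p G)
    (hU : ∀ x y : G, x ^ p = 1 → x ≠ 1 → y ^ p = 1 → y ∈ Subgroup.zpowers x)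
    {β : G → G → ℂˣ} (hβ : Is2Cocycle β) : Is2Coboundary β := by
  obtain ⟨N, hN, hNc, g, hg⟩ := hG.exists_normal_zpow_mul_mem hU
  have hcomm : ∀ x y : CocycleExt hβ,
      Commute (CocycleExt.proj hβ x) (CocycleExt.proj hβ y) → Commute x y := by
    intro x y hxy
    let H := Subgroup.closure {CocycleExt.proj hβ x, CocycleExt.proj hβ y}
    have hH : ∀ a ∈ H, ∀ b ∈ H, a * b = b * a := by
      have := Subgroup.isMulCommutative_closure
        (k := {CocycleExt.proj hβ x, CocycleExt.proj hβ y}) (by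
          rintro a (rfl | rfl) b (rfl | rfl)
          exacts [rfl, hxy, hxy.symm, rfl])
      exact fun a ha b hb => congrArg Subtype.val (this.is_comm.comm ⟨a, ha⟩ ⟨b, hb⟩)
    obtain ⟨c, hc⟩ := (hG.isCyclic_subgroup_of_unique hU H hH).exists_generator
    have hmem : ∀ a ∈ H, a ∈ Subgroup.zpowers (c : G) := fun a ha => by
      obtain ⟨i, hi⟩ := Subgroup.mem_zpowers_iff.1 (hc ⟨a, ha⟩)
      exact ⟨i, by simpa using congrArg Subtype.val hi⟩
    exact CocycleExt.commute_of_proj_mem_zpowers hβ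
      (hmem _ (Subgroup.subset_closure (by simp))) (hmem _ (Subgroup.subset_closure (by simp)))
  obtain ⟨χ, hχ⟩ := exists_monoidHom_units_complex_retraction (CocycleExt.incl hβ) fun z hz =>
    congrArg CocycleExt.fst (eq_one_of_mem_ker_of_mem_commutator (CocycleExt.proj hβ)
      (CocycleExt.proj_surjective hβ) hcomm N hNc g hg rfl hz)
  simpa using CocycleExt.is2Coboundary_pow hβ χ 1 (by simpa using hχ)

/-- If a 2-cocycle is trivial on a subgroup of finite index `n`, then its `n`-th power is
trivial. -/
theorem is2Coboundary_pow_index {G : Type*} [Group G] {β : G → G → ℂˣ} (hβ : Is2Cocycle β)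
    (P : Subgroup G) [P.FiniteIndex] (hP : Is2Coboundary fun x y : P => β x y) :
    Is2Coboundary fun x y => β x y ^ P.index := by
  obtain ⟨f, hf1, hf⟩ := hP
  let H := P.comap (CocycleExt.proj hβ)
  have hindex : H.index = P.index :=
    P.index_comap_of_surjective (CocycleExt.proj_surjective hβ)
  have : H.FiniteIndex := ⟨hindex ▸ Subgroup.FiniteIndex.index_ne_zero⟩
  let φ : H →* ℂˣ :=
    { toFun := fun x => x.1.fst * f ⟨x.1.snd, x.2⟩
      map_one' := by
        change 1 * f 1 = 1
        rw [hf1, one_mul]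
      map_mul' := fun x y => by
        have h := hf ⟨x.1.snd, x.2⟩ ⟨y.1.snd, y.2⟩
        change x.1.fst * y.1.fst * β x.1.snd y.1.snd * f (⟨x.1.snd, x.2⟩ * ⟨y.1.snd, y.2⟩) = _
        rw [eq_div_iff_mul_eq'] at h
        rw [mul_assoc]
        exact (congrArg (x.1.fst * y.1.fst * ·) h).trans (mul_mul_mul_comm _ _ _ _) }
  refine CocycleExt.is2Coboundary_pow hβ (MonoidHom.transfer φ) _ fun z => ?_
  rw [MonoidHom.transfer_eq_pow φ _ fun k g _ => by
    rw [← map_pow, mul_assoc, (CocycleExt.commute_incl hβ _ _).eq, inv_mul_cancel_left]]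
  simp only [← map_pow, hindex]
  change z ^ P.index * f 1 = _
  rw [hf1, mul_one]

theorem Is2Coboundary.mul {G : Type*} [Group G] {β γ : G → G → ℂˣ} (hβ : Is2Coboundary β)
    (hγ : Is2Coboundary γ) : Is2Coboundary fun x y => β x y * γ x y := by
  obtain ⟨f, hf1, hf⟩ := hβ
  obtain ⟨g, hg1, hg⟩ := hγ
  refine ⟨fun x => f x * g x, by simp [hf1, hg1], fun x y => ?_⟩
  simp only [hf, hg, div_mul_div_comm, mul_mul_mul_comm]

theorem Is2Coboundary.zpow {G : Type*} [Group G] {β : G → G → ℂˣ} (hβ : Is2Coboundary β)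
    (n : ℤ) : Is2Coboundary fun x y => β x y ^ n := by
  obtain ⟨f, hf1, hf⟩ := hβ
  exact ⟨fun x => f x ^ n, by simp [hf1], fun x y => by simp only [hf, div_zpow, mul_zpow]⟩

theorem Is2Coboundary.of_pow_coprime {G : Type*} [Group G] {β : G → G → ℂˣ} {m n : ℕ}
    (hmn : m.Coprime n) (hm : Is2Coboundary fun x y => β x y ^ m)
    (hn : Is2Coboundary fun x y => β x y ^ n) : Is2Coboundary β := by
  convert (hm.zpow (m.gcdA n)).mul (hn.zpow (m.gcdB n)) using 3 with x y
  rw [← zpow_natCast, ← zpow_natCast, ← zpow_mul, ← zpow_mul, ← zpow_add, ← Nat.gcd_eq_gcd_ab,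
    hmn.gcd_eq_one, Nat.cast_one, zpow_one]

theorem is2Coboundary_gam_pow {G : Type*} [Group G] {ω : G → G → G → ℂˣ}
    (hω : IsNormalized3Cocycle ω) {a : G} (ha : ∀ x, x * a = a * x) {n : ℕ} (hn : a ^ n = 1) :
    Is2Coboundary fun x y => gam ω a x y ^ n := by
  have key : ∀ k : ℕ, Is2Coboundary fun x y => gam ω a x y ^ k / gam ω (a ^ k) x y := by
    intro k
    induction k with
    | zero => exact ⟨fun _ => 1, rfl, fun x y => by simp [gam, hω.2]⟩
    | succ k ih =>
      have hak : ∀ x, x * a ^ k = a ^ k * x := fun x =>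
        (Commute.pow_right (show Commute x a from ha x) k).eq
      convert ih.mul (is2Coboundary_gam_mul hω hak ha) using 3 with x y
      rw [pow_succ, pow_succ, ← mul_div_assoc, ← mul_assoc, div_mul_cancel]
  convert key n using 3 with x y
  simp [hn, gam, hω.2]

theorem unique_subgroup_le_Zomega {G : Type*} [Group G] [Finite G]
    (p : ℕ) (hp : p.Prime) (A : Subgroup G) (hA : Nat.card A = p)
    (huniq : ∀ B : Subgroup G, Nat.card B = p → B = A)
    (hAZ : A ≤ Subgroup.center G)
    (ω : G → G → G → ℂˣ) (hω : IsNormalized3Cocycle ω) :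
    ∀ a ∈ A, Is2Coboundary (gam ω a) := by
  intro a haA
  have : Fact p.Prime := ⟨hp⟩
  have ha : ∀ x, x * a = a * x := Subgroup.mem_center_iff.1 (hAZ haA)
  have hap : a ^ p = 1 := by
    have := pow_card_eq_one' (x := (⟨a, haA⟩ : A))
    rw [hA] at this
    exact congrArg Subtype.val this
  have hβ := is2Cocycle_gam hω ha
  have hzp : ∀ x : G, x ^ p = 1 → x ≠ 1 → Subgroup.zpowers x = A := fun x hx hx1 =>
    huniq _ (by rw [Nat.card_zpowers, orderOf_eq_prime hx hx1])
  have hU : ∀ x y : G, x ^ p = 1 → x ≠ 1 → y ^ p = 1 → y ∈ Subgroup.zpowers x := by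
    intro x y hx hx1 hy
    obtain rfl | hy1 := eq_or_ne y 1
    · exact one_mem _
    · rw [hzp x hx hx1, ← hzp y hy hy1]
      exact Subgroup.mem_zpowers y
  obtain ⟨P⟩ : Nonempty (Sylow p G) := inferInstance
  have hUP : ∀ x y : P, x ^ p = 1 → x ≠ 1 → y ^ p = 1 → y ∈ Subgroup.zpowers x := by
    intro x y hx hx1 hy
    obtain ⟨i, hi⟩ := Subgroup.mem_zpowers_iff.1 (hU x y (by exact_mod_cast hx)
      (by exact_mod_cast hx1) (by exact_mod_cast hy))
    exact ⟨i, Subtype.ext (by simpa using hi)⟩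
  have hβP : Is2Cocycle fun x y : P => gam ω a x y :=
    ⟨fun x => hβ.1 x, fun x y z => hβ.2 x y z⟩
  refine Is2Coboundary.of_pow_coprime ((Nat.Prime.coprime_iff_not_dvd hp).2 P.not_dvd_index)
    (is2Coboundary_gam_pow hω ha hap) (is2Coboundary_pow_index hβ P ?_)
  exact P.2.is2Coboundary_of_unique hUP hβP
end

section
/- Let G be a finite group containing exactly one element z of order 2, and let ω be a normalized 3-cocycle on G with values in ℂˣ. Suppose τ : G → ℂˣ is a map with τ(1) = 1 and γ_z(x,y) = τ(x)·τ(y)/τ(x*y) for all x, y ∈ G. Then there exists a group homomorphism χ : G → ℂˣ such that θ_g(z,z)·τ(g)² = χ(g)² for all g ∈ G. (This expresses the splitting of the short exact sequence 1 → Ĝ → Γ₀^ω(G,A) → A → 1 for A = {1, z}.) -/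
lemma cjg_of_commute {G : Type*} [Group G] {g x : G} (h : Commute g x) : cjg g x = g := by
  rw [cjg, mul_assoc, h.eq, inv_mul_cancel_left]

namespace IsNormalized3Cocycle

variable {G : Type*} [Group G] {ω : G → G → G → ℂˣ}

lemma ofMul_eq (hω : IsNormalized3Cocycle ω) (x y z w : G) :
    Additive.ofMul (ω y z w) + Additive.ofMul (ω x (y * z) w) + Additive.ofMul (ω x y z) =
      Additive.ofMul (ω (x * y) z w) + Additive.ofMul (ω x y (z * w)) :=
  congrArg Additive.ofMul (hω.1 x y z w)

lemma theta_mul_gam_sq (hω : IsNormalized3Cocycle ω) {z : G} (hz : z * z = 1)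
    (hc : ∀ g, Commute z g) (g h : G) :
    theta ω g z z * theta ω h z z * gam ω z g h ^ 2 = theta ω (g * h) z z := by
  have hn := hω.2
  have e1 := hω.ofMul_eq g h z z
  have e2 := hω.ofMul_eq g z h z
  have e3 := hω.ofMul_eq z g h z
  have e4 := hω.ofMul_eq g z z h
  have e5 := hω.ofMul_eq z g z h
  have e6 := hω.ofMul_eq z z g h
  have hcz (g : G) : cjg g z = g := cjg_of_commute (hc g).symm
  have hc1 (g : G) : cjg g 1 = g := cjg_of_commute (Commute.one_right g)
  have hzg (g : G) : z * g = g * z := (hc g).eq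
  apply Additive.ofMul.injective
  simp only [theta, gam, hcz, hc1, hz, hzg, hn, true_or, or_true, ofMul_mul, ofMul_div, ofMul_pow,
    ofMul_one] at e1 e2 e3 e4 e5 e6 ⊢
  linear_combination (norm := abel) e1 - e2 + e3 + e4 - e5 + e6

lemma theta_mul_gam_eq (hω : IsNormalized3Cocycle ω) {x y z : G} (hx : x * x = z) (hy : y * y = z)
    (hz : z * z = 1) (hxy : x * y * x = y) :
    theta ω x z z * gam ω z x x = theta ω y z z * gam ω z y y := by
  have hn := hω.2
  obtain ⟨w, hw⟩ : ∃ w, y * x = w := ⟨_, rfl⟩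
  have c1 := hω.ofMul_eq x w y z
  have c2 := hω.ofMul_eq x w w x
  have c3 := hω.ofMul_eq z x w y
  have c4 := hω.ofMul_eq z z x w
  have c5 := hω.ofMul_eq y w w y
  have c6 := hω.ofMul_eq w y z z
  have c7 := hω.ofMul_eq w y w w
  have c8 := hω.ofMul_eq w w x z
  have c9 := hω.ofMul_eq w w (x * z) w
  have c10 := hω.ofMul_eq w w y z
  have a1 : x * w = y := by grind
  have a2 : w * y = x := by grind
  have a3 : w * w = z := by grind
  have a4 : w * x = y * z := by grind
  have a5 : z * x = x * z := by grind
  have a6 : y * w = x * z := by grind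
  have a7 : x * z * w = y * z := by grind
  have a8 : w * (x * z) = y := by grind
  have cx : cjg x z = x := cjg_of_commute a5.symm
  have cy : cjg y z = y := cjg_of_commute (by grind : y * z = z * y)
  have cxx : cjg x 1 = x := cjg_of_commute (Commute.one_right _)
  have cyy : cjg y 1 = y := cjg_of_commute (Commute.one_right _)
  apply Additive.ofMul.injective
  simp only [theta, gam, cx, cy, cxx, cyy, a1, a2, a3, a4, a5, a6, a7, a8, hz, hn, true_or,
    or_true, ofMul_mul, ofMul_div, ofMul_one] at c1 c2 c3 c4 c5 c6 c7 c8 c9 c10 ⊢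
  linear_combination (norm := abel) c1 - c2 - c3 + c4 + c5 - c6 - c7 + c8 + c9 - c10

end IsNormalized3Cocycle
namespace IsPGroup

variable {P : Type*} [Group P] [Finite P]

lemma exists_index_eq_two_of_ne_top (hP : IsPGroup 2 P) {H : Subgroup P} (hH : H ≠ ⊤) :
    ∃ K : Subgroup P, K.index = 2 ∧ H ≤ K := by
  obtain ⟨n, hn⟩ := IsPGroup.iff_card.mp hP
  obtain ⟨k, hk⟩ := IsPGroup.iff_card.mp (hP.to_subgroup H)
  have hkn : k < n := by
    refine lt_of_le_of_ne ?_ fun h ↦ hH (H.eq_top_of_card_eq (by rw [hn, hk, h]))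
    exact (Nat.pow_dvd_pow_iff_le_right one_lt_two).mp (hk ▸ hn ▸ H.card_subgroup_dvd_card)
  obtain ⟨K, hK, hHK⟩ := Sylow.exists_subgroup_card_pow_prime_le 2 (m := n - 1)
    (hn ▸ pow_dvd_pow 2 (Nat.sub_le n 1)) H hk (by omega)
  refine ⟨K, ?_, hHK⟩
  have h := K.card_mul_index
  rw [hn, hK, ← Nat.sub_add_cancel (Nat.one_le_of_lt hkn), pow_succ, Nat.add_sub_cancel] at h
  exact Nat.eq_of_mul_eq_mul_left (by positivity) h

lemma exists_ne_index_eq_two (hP : IsPGroup 2 P) (hc : ¬ IsCyclic P) :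
    ∃ A B : Subgroup P, A.index = 2 ∧ B.index = 2 ∧ A ≠ B := by
  have hz (g : P) : Subgroup.zpowers g ≠ ⊤ := fun h ↦
    hc (isCyclic_iff_exists_zpowers_eq_top.mpr ⟨g, h⟩)
  obtain ⟨A, hA, -⟩ := hP.exists_index_eq_two_of_ne_top (hz 1)
  obtain ⟨g, hg⟩ : ∃ g, g ∉ A := by
    by_contra! h
    simp [(Subgroup.eq_top_iff' A).mpr h] at hA
  obtain ⟨B, hB, hgB⟩ := hP.exists_index_eq_two_of_ne_top (hz g)
  exact ⟨A, B, hA, hB, fun h ↦ hg (h ▸ hgB (Subgroup.mem_zpowers g))⟩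

end IsPGroup

namespace Subgroup

variable {P : Type*} [Group P]

lemma exists_third_index_eq_two {A B : Subgroup P} (hA : A.index = 2) (hB : B.index = 2)
    (hAB : A ≠ B) : ∃ C : Subgroup P, C.index = 2 ∧ C ≠ A ∧ C ≠ B := by
  have hmA {a b : P} := mul_mem_iff_of_index_two hA (a := a) (b := b)
  have hmB {a b : P} := mul_mem_iff_of_index_two hB (a := a) (b := b)
  let C : Subgroup P :=
    { carrier := {g | g ∈ A ↔ g ∈ B}
      mul_mem' := fun {a b} ha hb ↦ by
        simp only [Set.mem_ofPred_eq] at ha hb ⊢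
        rw [hmA, hmB, ha, hb]
      one_mem' := by simp
      inv_mem' := by simp }
  have hC (g : P) : g ∈ C ↔ (g ∈ A ↔ g ∈ B) := Iff.rfl
  obtain ⟨u, hu⟩ : ∃ u, ¬(u ∈ A ↔ u ∈ B) := by
    by_contra! h
    exact hAB (Subgroup.ext h)
  have ne (H : Subgroup P) (hH : H.index = 2) : ∃ v, v ∉ H := by
    by_contra! h
    simp [(Subgroup.eq_top_iff' H).mpr h] at hH
  obtain ⟨v, hv⟩ := ne A hA
  obtain ⟨w, hw⟩ := ne B hB
  refine ⟨C, ?_, fun h ↦ ?_, fun h ↦ ?_⟩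
  · rw [index_eq_two_iff]
    refine ⟨u, fun b ↦ ?_⟩
    simp only [hC, hmA, hmB]
    unfold Xor
    tauto
  · have h1 := h ▸ hC w
    have h2 := h ▸ hC u
    have h3 := h ▸ hC (u * w)
    simp only [hmA, hmB] at h3
    tauto
  · have h1 := h ▸ hC v
    have h2 := h ▸ hC u
    have h3 := h ▸ hC (u * v)
    simp only [hmA, hmB] at h3
    tauto

end Subgroup

section

variable {M : Type*} [Group M] {a b c s : M}

lemma Commute.mul_self_eq_one_of_mul_eq (hc : a * b = c * (b * a)) (hca : Commute c a)
    (hab : Commute (a * a) b) : c * c = 1 := by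
  refine mul_right_cancel (b := b * (a * a)) ?_
  calc c * c * (b * (a * a)) = c * (c * (b * a)) * a := by simp only [mul_assoc]
    _ = c * a * b * a := by rw [← hc]; simp only [mul_assoc]
    _ = a * (c * (b * a)) := by rw [hca.eq]; simp only [mul_assoc]
    _ = 1 * (b * (a * a)) := by rw [← hc, ← mul_assoc, hab.eq, one_mul]

lemma Commute.mul_inv_mul_self (hs : Commute s a) :
    a * s⁻¹ * (a * s⁻¹) = a * a * (s * s)⁻¹ := by
  rw [mul_assoc, ← mul_assoc s⁻¹, hs.inv_left.eq, mul_inv_rev]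
  simp only [mul_assoc]

lemma Commute.mul_inv_mul_self_of_mul_eq (hc : a * b = c * (b * a)) (hca : Commute c a)
    (hcb : Commute c b) : a * b⁻¹ * (a * b⁻¹) = c * (a * a * (b * b)⁻¹) := by
  have h : b⁻¹ * a = c * (a * b⁻¹) := by
    refine mul_left_cancel (a := b) (mul_right_cancel (b := b) ?_)
    rw [mul_inv_cancel_left, ← mul_assoc, ← hcb.eq, hc]
    simp only [mul_assoc, inv_mul_cancel, mul_one]
  rw [mul_assoc, ← mul_assoc b⁻¹, h, mul_inv_rev]
  simp only [← mul_assoc]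
  rw [hca.eq]

end

namespace Subgroup

variable {P : Type*} [Group P] {A B : Subgroup P}

lemma exists_zpow_mul_self_eq {b d : P} (hA : A.index = 2) (hbA : b ∉ A) (hd : d ∈ A)
    (hdb : d ∈ zpowers b) : ∃ m : ℤ, d = (b * b) ^ m := by
  obtain ⟨k, rfl⟩ := mem_zpowers_iff.mp hdb
  have hbb (m : ℤ) : b ^ (m + m) = (b * b) ^ m := by
    rw [zpow_add, (Commute.refl b).mul_zpow]
  obtain ⟨m, rfl | rfl⟩ := Int.even_or_odd' k
  · exact ⟨m, by rw [two_mul, hbb]⟩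
  · rw [two_mul, zpow_add_one, hbb] at hd
    exact absurd ((A.mul_mem_cancel_left
      (A.zpow_mem (mul_self_mem_of_index_two hA b) m)).mp hd) hbA

lemma forall_mem_of_index_eq_two {K : Subgroup P} (hB : B.index = 2) (hAB : ¬ A ≤ B) (hAK : A ≤ K)
    (hBK : B ≤ K) (g : P) : g ∈ K := by
  obtain ⟨a, ha, haB⟩ := SetLike.not_le_iff_exists.mp hAB
  by_cases hg : g ∈ B
  · exact hBK hg
  · rw [← mul_inv_cancel_right g a]
    exact K.mul_mem (hBK ((mul_mem_iff_of_index_two hB).mpr (by tauto))) (K.inv_mem (hAK ha))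

lemma not_le_of_index_eq [Finite P] (h : A.index = B.index) (hAB : A ≠ B) : ¬ A ≤ B := by
  refine fun hle ↦ hAB (eq_of_le_of_card_ge hle (le_of_eq ?_))
  have hA := A.card_mul_index
  rw [h, ← B.card_mul_index] at hA
  exact (Nat.eq_of_mul_eq_mul_right (Nat.pos_of_ne_zero B.index_ne_zero_of_finite) hA).symm

end Subgroup

namespace IsPGroup

open Subgroup

variable {P : Type*} [Group P]

lemma exists_pow_involution (hP : IsPGroup 2 P) {s : P} (hs : s ≠ 1) :
    ∃ n : ℕ, s ^ n * s ^ n = 1 ∧ s ^ n ≠ 1 := by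
  obtain ⟨k, hk⟩ := IsPGroup.iff_orderOf.mp hP s
  cases k with
  | zero => exact absurd (orderOf_eq_one_iff.mp (by simpa using hk)) hs
  | succ k =>
    refine ⟨2 ^ k, ?_, fun h ↦ ?_⟩
    · rw [← pow_add, ← two_mul, ← pow_succ', ← hk, pow_orderOf_eq_one]
    · have := orderOf_dvd_of_pow_eq_one h
      rw [hk, Nat.pow_dvd_pow_iff_le_right one_lt_two] at this
      omega

lemma eq_one_of_odd_zpow_eq_one (hP : IsPGroup 2 P) {x : P} {n : ℤ} (hn : Odd n)
    (h : x ^ n = 1) : x = 1 := by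
  obtain ⟨k, hk⟩ := IsPGroup.iff_orderOf.mp hP x
  have hd : ((2 ^ k : ℕ) : ℤ) ∣ n := hk ▸ orderOf_dvd_iff_zpow_eq_one.mpr h
  cases k with
  | zero => exact orderOf_eq_one_iff.mp (by simpa using hk)
  | succ k =>
    have h2 : (2 : ℤ) ∣ n := (Dvd.intro_left ((2 : ℤ) ^ k) (by push_cast; ring)).trans hd
    exact absurd (even_iff_two_dvd.mpr h2) (Int.not_even_iff_odd.mpr hn)

lemma exists_quaternion_generators [Finite P] (hP : IsPGroup 2 P)
    (hu : ∀ v w : P, v * v = 1 → w * w = 1 → v ≠ 1 → w ≠ 1 → v = w) {A B : Subgroup P}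
    (hA : A.index = 2) (hB : B.index = 2) (hAB : A ≠ B) (cA : IsCyclic A) (cB : IsCyclic B) :
    ∃ a b : P, zpowers a = A ∧ zpowers b = B ∧ a * a = b * b ∧ a * b * a = b := by
  obtain ⟨a, ha⟩ := A.isCyclic_iff_exists_zpowers_eq_top.mp cA
  obtain ⟨b, hb⟩ := B.isCyclic_iff_exists_zpowers_eq_top.mp cB
  have hnAB := not_le_of_index_eq (hA.trans hB.symm) hAB
  have hnBA := not_le_of_index_eq (hB.trans hA.symm) hAB.symm
  have haA : a ∈ A := ha ▸ mem_zpowers a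
  have hbB : b ∈ B := hb ▸ mem_zpowers b
  have haB : a ∉ B := fun h ↦ hnAB (ha ▸ zpowers_le.mpr h)
  have hbA : b ∉ A := fun h ↦ hnBA (hb ▸ zpowers_le.mpr h)
  have ha1 : a ≠ 1 := fun h ↦ haB (h ▸ B.one_mem)
  have hb1 : b ≠ 1 := fun h ↦ hbA (h ▸ A.one_mem)
  have haaB := mul_self_mem_of_index_two hB a
  have hbbA := mul_self_mem_of_index_two hA b
  have central {d : P} (hdA : d ∈ A) (hdB : d ∈ B) (g : P) : d * g = g * d := by
    have hg : g ∈ centralizer {d} := by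
      refine forall_mem_of_index_eq_two hB hnAB ?_ ?_ g
      · rw [← ha, zpowers_le, mem_centralizer_singleton_iff]
        obtain ⟨k, rfl⟩ := mem_zpowers_iff.mp (ha ▸ hdA)
        exact (Commute.self_zpow a k).eq
      · rw [← hb, zpowers_le, mem_centralizer_singleton_iff]
        obtain ⟨k, rfl⟩ := mem_zpowers_iff.mp (hb ▸ hdB)
        exact (Commute.self_zpow b k).eq
    exact (mem_centralizer_singleton_iff.mp hg).symm
  have inv_mem {w : P} (hw : w * w = 1) : w ∈ A ∧ w ∈ B := by
    by_cases hw1 : w = 1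
    · exact hw1 ▸ ⟨A.one_mem, B.one_mem⟩
    have key {s : P} (hsA : s ∈ A) (hsB : s ∈ B) (hs : s ≠ 1) : w ∈ A ∧ w ∈ B := by
      obtain ⟨n, hn, hn1⟩ := hP.exists_pow_involution hs
      exact hu _ _ hn hw hn1 hw1 ▸ ⟨A.pow_mem hsA n, B.pow_mem hsB n⟩
    by_cases haa : a * a = 1
    · by_cases hbb : b * b = 1
      · exact absurd (hu _ _ haa hbb ha1 hb1 ▸ hbB) haB
      · exact key hbbA (B.mul_mem hbB hbB) hbb
    · exact key (A.mul_mem haA haA) haaB haa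
  obtain ⟨m, hm⟩ := exists_zpow_mul_self_eq hA hbA (A.mul_mem haA haA) (hb ▸ haaB)
  have haa := central (A.mul_mem haA haA) haaB
  have hbb := central hbbA (B.mul_mem hbB hbB)
  obtain ⟨c, hc⟩ : ∃ c, a * b = c * (b * a) := ⟨a * b * (b * a)⁻¹, by group⟩
  have hcA : c ∈ A := by
    rw [eq_mul_inv_of_mul_eq hc.symm]
    simp [mul_mem_iff_of_index_two hA, haA]
  have hcB : c ∈ B := by
    rw [eq_mul_inv_of_mul_eq hc.symm]
    simp [mul_mem_iff_of_index_two hB, hbB]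
  have hcc : c * c = 1 := Commute.mul_self_eq_one_of_mul_eq hc (central hcA hcB a) (haa b)
  have not_inv {s : P} (hs : s ∈ B) : a * s * (a * s) ≠ 1 := fun h ↦
    haB ((B.mul_mem_cancel_right hs).mp (inv_mem h).2)
  obtain ⟨r, hr | hr⟩ := Int.even_or_odd' m
  · exfalso
    have hsA : (b * b) ^ r ∈ A := A.zpow_mem hbbA r
    have hsB : (b * b) ^ r ∈ B := B.zpow_mem (B.mul_mem hbB hbB) r
    refine not_inv (B.inv_mem hsB) ?_
    rw [Commute.mul_inv_mul_self (central hsA hsB a), hm, hr, two_mul, zpow_add, mul_inv_cancel]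
  · have hsA : (b * b) ^ r ∈ A := A.zpow_mem hbbA r
    have hsB : (b * b) ^ r ∈ B := B.zpow_mem (B.mul_mem hbB hbB) r
    rw [hr, two_mul, zpow_add_one, zpow_add] at hm
    have hs := central hsA hsB
    generalize (b * b) ^ r = s at hm hsA hsB hs
    have hteB : b⁻¹ * s⁻¹ ∈ B := B.mul_mem (B.inv_mem hbB) (B.inv_mem hsB)
    have hee : a * (b⁻¹ * s⁻¹) * (a * (b⁻¹ * s⁻¹)) = c := by
      rw [← mul_assoc a, Commute.mul_inv_mul_self (hs (a * b⁻¹)),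
        Commute.mul_inv_mul_self_of_mul_eq hc (central hcA hcB a) (central hcA hcB b), hm,
        mul_inv_cancel_right, mul_inv_cancel_right]
    obtain ⟨n, hn⟩ := exists_zpow_mul_self_eq hB haB hcB (ha ▸ hcA)
    have hcaa : c = a * a := by
      obtain ⟨q, hq | hq⟩ := Int.even_or_odd' n
      · exfalso
        have htA : (a * a) ^ q ∈ A := A.zpow_mem (A.mul_mem haA haA) q
        have htB : (a * a) ^ q ∈ B := B.zpow_mem haaB q
        refine not_inv (B.mul_mem hteB (B.inv_mem htB)) ?_
        rw [← mul_assoc a, Commute.mul_inv_mul_self (central htA htB _), hee, hn, hq, two_mul,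
          zpow_add, mul_inv_cancel]
      · have h1 : a * a * (a * a) = 1 := by
          refine hP.eq_one_of_odd_zpow_eq_one (n := n) ⟨q, hq⟩ ?_
          rw [(Commute.refl (a * a)).mul_zpow, ← hn, hcc]
        rw [hn, hq, two_mul, zpow_add_one, zpow_add, ← (Commute.refl (a * a)).mul_zpow, h1, one_zpow,
          one_mul]
    have hcbb : c = b * b := by
      obtain ⟨k, hk⟩ := exists_zpow_mul_self_eq hB haB (B.mul_mem hbB hbB) (ha ▸ hbbA)
      refine hu _ _ hcc ?_ (fun h ↦ haB (inv_mem (hcaa ▸ h)).2) fun h ↦ hbA (inv_mem h).1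
      rw [hk, ← hcaa, ← (Commute.refl c).mul_zpow, hcc, one_zpow]
    refine ⟨a, b, ha, hb, hcaa ▸ hcbb, ?_⟩
    rw [hc, mul_assoc, mul_assoc, ← hcaa, ← central hcA hcB b, ← mul_assoc, hcc, one_mul]

lemma map_eq_one_of_not_isCyclic {M : Type*} [Group M] [Finite P] (hP : IsPGroup 2 P)
    (hu : ∀ v w : P, v * v = 1 → w * w = 1 → v ≠ 1 → w ≠ 1 → v = w) (ψ : P →* M)
    (hψ : ∀ x y : P, x * x = y * y → x * y * x = y → ψ x = 1) (hc : ¬ IsCyclic P) (g : P) :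
    ψ g = 1 := by
  induction h : Nat.card P using Nat.strong_induction_on generalizing P with
  | _ n ih =>
  have ih' {X : Subgroup P} (hX : X.index = 2) (cX : ¬ IsCyclic X) : X ≤ ψ.ker := by
    intro x hx
    have hcard := X.card_mul_index
    rw [hX] at hcard
    have hpos : 0 < Nat.card X := Nat.card_pos
    refine ih (Nat.card X) (by omega) (hP.to_subgroup X)
      (fun v w hv hw hv1 hw1 ↦ ?_) (ψ.comp X.subtype)
      (fun u v h1 h2 ↦ ?_) cX ⟨x, hx⟩ rfl
    · exact Subtype.ext (hu v w (by exact_mod_cast hv) (by exact_mod_cast hw)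
        (by exact_mod_cast hv1) (by exact_mod_cast hw1))
    · exact hψ u v (by exact_mod_cast h1) (by exact_mod_cast h2)
  have key {X Y : Subgroup P} (hX : X.index = 2) (hY : Y.index = 2) (hXY : X ≠ Y)
      (hcXY : IsCyclic X ↔ IsCyclic Y) : ψ g = 1 := by
    suffices X ≤ ψ.ker ∧ Y ≤ ψ.ker from
      forall_mem_of_index_eq_two hY (not_le_of_index_eq (hX.trans hY.symm) hXY) this.1 this.2 g
    by_cases cX : IsCyclic X
    · obtain ⟨a, b, rfl, rfl, h1, h2⟩ :=
        hP.exists_quaternion_generators hu hX hY hXY cX (hcXY.mp cX)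
      simp only [zpowers_le, MonoidHom.mem_ker]
      refine ⟨hψ a b h1 h2, hψ b a h1.symm (mul_left_cancel (a := a) ?_)⟩
      rw [← mul_assoc, ← mul_assoc, h2, h1]
    · exact ⟨ih' hX cX, ih' hY (mt hcXY.mpr cX)⟩
  obtain ⟨A, B, hA, hB, hAB⟩ := hP.exists_ne_index_eq_two hc
  obtain ⟨C, hC, hCA, hCB⟩ := exists_third_index_eq_two hA hB hAB
  by_cases h1 : IsCyclic A ↔ IsCyclic B
  · exact key hA hB hAB h1
  by_cases h2 : IsCyclic C ↔ IsCyclic A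
  · exact key hC hA hCA h2
  · exact key hC hB hCB (by tauto)

end IsPGroup

section

variable {G M : Type*} [Group G] [Finite G] [CommGroup M] (P : Sylow 2 G) (ψ : G →* M)

lemma Sylow.exists_eq_sq_of_le_ker (h : (P : Subgroup G) ≤ ψ.ker) :
    ∃ χ : G →* M, ψ = χ ^ 2 := by
  have hodd : Odd ψ.ker.index := by
    rw [← Nat.not_even_iff_odd, even_iff_two_dvd]
    exact fun h2 ↦ P.not_dvd_index (h2.trans (Subgroup.index_dvd_of_le h))
  obtain ⟨k, hk⟩ := hodd
  refine ⟨ψ ^ (k + 1), MonoidHom.ext fun g ↦ ?_⟩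
  have hg : ψ g ^ (2 * k + 1) = 1 := by
    rw [← map_pow, ← hk]
    exact ψ.ker.pow_index_mem g
  rw [← pow_mul, MonoidHom.pow_apply, show (k + 1) * 2 = 2 * k + 1 + 1 by ring, pow_succ, hg,
    one_mul]

lemma IsCyclic.exists_eq_sq {P : Type*} [Group P] [IsCyclic P] (hP : Even (Nat.card P))
    (φ : P →* ℂˣ) (hφ : ∀ x : P, x * x = 1 → φ x = 1) : ∃ χ : P →* ℂˣ, φ = χ ^ 2 := by
  obtain ⟨p, hp⟩ := IsCyclic.exists_generator (α := P)
  obtain ⟨k, hk⟩ := hP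
  obtain ⟨s, hs⟩ : ∃ s : ℂˣ, φ p = s ^ 2 := by
    obtain ⟨s, hs⟩ := IsAlgClosed.exists_pow_nat_eq (φ p : ℂ) two_pos
    have hs0 : s ≠ 0 := by
      rintro rfl
      exact (φ p).ne_zero (by rw [← hs, zero_pow two_ne_zero])
    exact ⟨Units.mk0 s hs0, Units.ext hs.symm⟩
  have hord : orderOf s ∣ orderOf p := by
    rw [orderOf_eq_card_of_forall_mem_zpowers hp]
    refine orderOf_dvd_of_pow_eq_one ?_
    rw [hk, ← two_mul, pow_mul, ← hs, ← map_pow]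
    exact hφ _ (by rw [← pow_add, ← hk, pow_card_eq_one'])
  refine ⟨monoidHomOfForallMemZpowers hp hord, (MonoidHom.eq_iff_eq_on_generator hp _ _).mpr ?_⟩
  rw [MonoidHom.pow_apply, monoidHomOfForallMemZpowers_apply_gen, hs]

lemma Sylow.exists_eq_sq_of_isCyclic [IsCyclic P] (hG : (Nat.card G).minFac = 2) (χ : P →* M)
    (hχ : ψ.comp (P : Subgroup G).subtype = χ ^ 2) : ∃ ξ : G →* M, ψ = ξ ^ 2 := by
  have hP := IsCyclic.normalizer_le_centralizer (P := P) hG ‹_›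
  obtain ⟨k, hk⟩ : Odd (P : Subgroup G).index := by
    rw [← Nat.not_even_iff_odd, even_iff_two_dvd]
    exact P.not_dvd_index
  have hle : (P : Subgroup G) ≤
      (ψ ^ (P : Subgroup G).index * (χ.comp (MonoidHom.transferSylow P hP) ^ 2)⁻¹).ker := by
    intro g hg
    have h := DFunLike.congr_fun hχ (⟨g, hg⟩ ^ (P : Subgroup G).index)
    have hV : MonoidHom.transferSylow P hP g = ⟨g, hg⟩ ^ (P : Subgroup G).index :=
      MonoidHom.transferSylow_eq_pow P hP g hg
    rw [MonoidHom.mem_ker, MonoidHom.mul_apply, MonoidHom.inv_apply, mul_inv_eq_one,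
      MonoidHom.pow_apply, MonoidHom.pow_apply, MonoidHom.comp_apply, hV]
    simpa using h
  obtain ⟨ξ, hξ⟩ := P.exists_eq_sq_of_le_ker _ hle
  refine ⟨ξ * χ.comp (MonoidHom.transferSylow P hP) * (ψ ^ k)⁻¹, ?_⟩
  rw [mul_pow, mul_pow, ← hξ, inv_mul_cancel_right, hk, inv_pow, ← pow_mul, mul_comm k, pow_succ,
    mul_comm, inv_mul_cancel_left]

lemma MonoidHom.exists_eq_sq_of_unique_involution {z : G} (hz2 : z * z = 1) (hz1 : z ≠ 1)
    (huniq : ∀ w : G, w * w = 1 → w ≠ 1 → w = z) (ψ : G →* ℂˣ) (hψz : ψ z = 1)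
    (hψ : ∀ x y : G, x * x = y * y → x * y * x = y → ψ x = 1) : ∃ χ : G →* ℂˣ, ψ = χ ^ 2 := by
  have P : Sylow 2 G := default
  have h2 : 2 ∣ Nat.card G := by
    rw [← orderOf_eq_prime (p := 2) (by rwa [pow_two]) hz1]
    exact orderOf_dvd_natCard z
  by_cases hP : IsCyclic P
  · obtain ⟨χ, hχ⟩ := IsCyclic.exists_eq_sq (even_iff_two_dvd.mpr (P.dvd_card_of_dvd_card h2))
      (ψ.comp (P : Subgroup G).subtype) fun x hx ↦ by
        by_cases hx1 : x = 1
        · rw [hx1, map_one]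
        · rw [MonoidHom.comp_apply, Subgroup.subtype_apply, huniq x (by exact_mod_cast hx)
            (by exact_mod_cast hx1), hψz]
    exact P.exists_eq_sq_of_isCyclic ψ ((Nat.minFac_eq_two_iff _).mpr h2) χ hχ
  · refine P.exists_eq_sq_of_le_ker ψ fun g hg ↦ ?_
    refine P.isPGroup'.map_eq_one_of_not_isCyclic (fun v w hv hw hv1 hw1 ↦ Subtype.ext ?_)
      (ψ.comp (P : Subgroup G).subtype) (fun x y h1 h2 ↦ ?_) hP ⟨g, hg⟩
    · rw [huniq v (by exact_mod_cast hv) (by exact_mod_cast hv1),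
        huniq w (by exact_mod_cast hw) (by exact_mod_cast hw1)]
    · exact hψ x y (by exact_mod_cast h1) (by exact_mod_cast h2)

end

theorem splitting_unique_involution {G : Type*} [Group G] [Finite G]
    (z : G) (hz2 : z * z = 1) (hz1 : z ≠ 1)
    (huniq : ∀ w : G, w * w = 1 → w ≠ 1 → w = z)
    (ω : G → G → G → ℂˣ) (hω : IsNormalized3Cocycle ω)
    (τ : G → ℂˣ) (hτ1 : τ 1 = 1)
    (hτ : ∀ x y : G, gam ω z x y = τ x * τ y / τ (x * y)) :
    ∃ χ : G →* ℂˣ, ∀ g : G, theta ω g z z * (τ g) ^ 2 = (χ g) ^ 2 := by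
  have hzc (g : G) : Commute z g := by
    have h : g * z * g⁻¹ = z := by
      refine huniq _ ?_ fun h ↦ hz1 (by simpa using h)
      rw [conj_mul, hz2, mul_one, mul_inv_cancel]
    exact (mul_inv_eq_iff_eq_mul.mp h).symm
  let ψ : G →* ℂˣ := MonoidHom.mk' (fun g ↦ theta ω g z z * τ g ^ 2) fun g h ↦ by
    rw [← hω.theta_mul_gam_sq hz2 hzc, hτ, div_pow, mul_pow, mul_assoc, mul_assoc,
      div_mul_cancel, mul_mul_mul_comm, ← mul_assoc, ← mul_assoc]
  have hψ (g : G) : ψ g = theta ω g z z * τ g ^ 2 := rfl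
  have hω2 : ω z z z * ω z z z = 1 := by
    have h := hω.1 z z z z
    rw [hz2, hω.2 z 1 z (by simp), hω.2 1 z z (by simp), hω.2 z z 1 (by simp)] at h
    simpa using h
  have hψz : ψ z = 1 := by
    have h := hτ z z
    rw [hz2, hτ1, div_one] at h
    simp only [gam, cjg_of_commute (hzc _), mul_div_cancel_right] at h
    rw [hψ, pow_two, ← h, theta, cjg_of_commute (hzc _), cjg_of_commute (hzc _),
      mul_div_cancel_right, hω2]
  have hψx {x : G} (hx : x * x = z) : ψ x = theta ω x z z * gam ω z x x * τ z := by
    rw [hψ, hτ, hx, mul_assoc, div_mul_cancel, pow_two]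
  have hψxy {x y : G} (hx : x * x = z) (hy : y * y = z) (hxy : x * y * x = y) : ψ x = ψ y := by
    rw [hψx hx, hψx hy, hω.theta_mul_gam_eq hx hy hz2 hxy]
  obtain ⟨χ, hχ⟩ := MonoidHom.exists_eq_sq_of_unique_involution hz2 hz1 huniq ψ hψz
    fun x y h1 h2 ↦ by
      have hxx : x * x * (x * x) = 1 := by
        refine mul_left_cancel (a := y) ?_
        calc y * (x * x * (x * x)) = x * x * y * (x * x) := by rw [h1]; simp only [mul_assoc]
          _ = x * (x * y * x) * x := by simp only [mul_assoc]
          _ = y * 1 := by rw [h2, h2, mul_one]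
      by_cases hx : x * x = 1
      · by_cases hx1 : x = 1
        · rw [hx1, map_one]
        · rw [huniq x hx hx1, hψz]
      · have hxz := huniq _ hxx hx
        have hyz : y * y = z := h1 ▸ hxz
        have h := hψxy hxz (y := x * y) (by rw [← mul_assoc, h2, hyz])
          (by rw [mul_assoc, h2])
        rw [hψxy hxz hyz h2]
        rwa [map_mul, left_eq_mul] at h
  exact ⟨χ, DFunLike.congr_fun hχ⟩
end

section
/- Let p be a prime, G a finite group, P a Sylow p-subgroup of G, M a representation of G on an abelian group (equivalently, a ℤ-linear representation of G), and n a positive integer. If the n-th group cohomology H^n(P, M|_P) of P with coefficients in the restriction of M to P is trivial (the zero group), then the p-primary torsion of H^n(G, M) is trivial: every element x ∈ H^n(G, M) with p^k · x = 0 for some k ≥ 0 satisfies x = 0. -/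
open CategoryTheory

namespace groupCohomology

universe u

instance functor_additive (k G : Type u) [CommRing k] [Group G] (n : ℕ) :
    (functor k G n).Additive :=
  inferInstanceAs (cochainsFunctor k G ⋙ HomologicalComplex.homologyFunctor _ _ n).Additive

variable {k G : Type u} [CommRing k] [Group G] (S : Subgroup G) (B : Rep.{u} k G)

/-- For an `S`-equivariant function `f : G → B`, the value `g • f g⁻¹` depends only on the coset
`g S`. -/
noncomputable def transferTerm (q : G ⧸ S) :
    (Rep.res S.subtype B).ρ.coindV S.subtype →ₗ[k] B :=
  Quotient.liftOn' q
    (fun g => B.ρ g ∘ₗ LinearMap.proj g⁻¹ ∘ₗ ((Rep.res S.subtype B).ρ.coindV S.subtype).subtype)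
    (fun a b hab => by
      ext f
      have hf := f.2 ⟨a⁻¹ * b, QuotientGroup.leftRel_apply.1 hab⟩ b⁻¹
      have hf' : f.1 a⁻¹ = B.ρ (a⁻¹ * b) (f.1 b⁻¹) := by simpa using hf
      simp [hf', ← Module.End.mul_apply, ← map_mul])

lemma transferTerm_mk (g : G) (f : (Rep.res S.subtype B).ρ.coindV S.subtype) :
    transferTerm S B (g : G ⧸ S) f = B.ρ g (f.1 g⁻¹) := rfl

lemma transferTerm_coind (h : G) (q : G ⧸ S) (f : (Rep.res S.subtype B).ρ.coindV S.subtype) :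
    transferTerm S B q (Representation.coind S.subtype (Rep.res S.subtype B).ρ h f) =
      B.ρ h (transferTerm S B (h⁻¹ • q) f) := by
  induction q using QuotientGroup.induction_on with
  | H g =>
    change _ = B.ρ h (transferTerm S B ((h⁻¹ * g : G) : G ⧸ S) f)
    rw [transferTerm_mk, transferTerm_mk, ← Module.End.mul_apply, ← map_mul]
    simp only [mul_inv_cancel_left, mul_inv_rev, inv_inv]
    rfl

/-- The transfer morphism from the coinduction of the restriction of `B` to `S` back to `B`,
sending `f` to the sum of `g • f g⁻¹` over the cosets `g S`. -/
noncomputable def transfer [Fintype (G ⧸ S)] :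
    Rep.coind S.subtype (Rep.res S.subtype B) ⟶ B :=
  Rep.ofHom ⟨∑ q : G ⧸ S, transferTerm S B q, fun h => by
    ext f
    simp only [LinearMap.comp_apply, LinearMap.sum_apply, map_sum]
    rw [← Equiv.sum_comp (MulAction.toPerm (h⁻¹ : G))
      (fun q : G ⧸ S => B.ρ h (transferTerm S B q f))]
    exact Finset.sum_congr rfl fun q _ => transferTerm_coind S B h q f⟩

lemma resCoindToHom_comp_transfer [Fintype (G ⧸ S)] :
    Rep.resCoindToHom S.subtype B _ (𝟙 (Rep.res S.subtype B)) ≫ transfer S B =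
      S.index • 𝟙 B := by
  ext m
  have key (q : G ⧸ S) : transferTerm S B q
      ((Rep.resCoindToHom S.subtype B _ (𝟙 (Rep.res S.subtype B))).hom m) = m := by
    induction q using QuotientGroup.induction_on with
    | H g =>
      rw [transferTerm_mk]
      change B.ρ g (B.ρ g⁻¹ m) = m
      simp
  change (∑ q : G ⧸ S, transferTerm S B q)
      ((Rep.resCoindToHom S.subtype B _ (𝟙 (Rep.res S.subtype B))).hom m) = S.index • m
  rw [LinearMap.sum_apply, Finset.sum_congr rfl fun q _ => key q]
  simp [Subgroup.index_eq_card]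

/-- If the cohomology of a finite index subgroup `S` vanishes in degree `n`, the index of `S`
annihilates the cohomology of the whole group in degree `n`. -/
lemma index_nsmul_eq_zero [S.FiniteIndex] (n : ℕ)
    (hS : Subsingleton (groupCohomology (Rep.res S.subtype B) n)) (x : groupCohomology B n) :
    S.index • x = 0 := by
  let _ : Fintype (G ⧸ S) := Subgroup.fintypeQuotientOfFiniteIndex
  have hC : Subsingleton (groupCohomology (Rep.coind S.subtype (Rep.res S.subtype B)) n) :=
    (coindIso (Rep.res S.subtype B) n).toLinearEquiv.toEquiv.subsingleton
  have h := congrArg (functor k G n).map (resCoindToHom_comp_transfer S B)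
  rw [Functor.map_comp, Functor.map_nsmul, CategoryTheory.Functor.map_id] at h
  have hx := congrArg (fun φ => φ.hom x) h
  have h0 : (functor k G n).map
      (Rep.resCoindToHom S.subtype B _ (𝟙 (Rep.res S.subtype B))) x = 0 := hC.elim _ _
  refine hx.symm.trans ?_
  change (functor k G n).map (transfer S B) ((functor k G n).map
    (Rep.resCoindToHom S.subtype B _ (𝟙 (Rep.res S.subtype B))) x) = 0
  rw [h0, map_zero]

end groupCohomology

theorem pTorsion_trivial_of_sylow_cohomology_trivial
    {G : Type} [Group G] [Finite G] (p : ℕ) (hp : p.Prime) (P : Sylow p G)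
    {M : Type} [AddCommGroup M] [Module ℤ M]
    (ρ : Representation ℤ G M) (n : ℕ) (hn : 0 < n)
    (hP : Subsingleton
      (groupCohomology (Rep.of (ρ.comp (P : Subgroup G).subtype)) n)) :
    ∀ x : groupCohomology (Rep.of ρ) n,
      (∃ k : ℕ, (p ^ k : ℤ) • x = 0) → x = 0 := by
  rintro x ⟨k, hk⟩
  have : Fact p.Prime := ⟨hp⟩
  have hi : (P : Subgroup G).index • x = 0 :=
    groupCohomology.index_nsmul_eq_zero (P : Subgroup G) (Rep.of ρ) n hP x
  have hk' : p ^ k • x = 0 := by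
    rw [← Nat.cast_smul_eq_nsmul ℤ]
    exact_mod_cast hk
  have hcop : Nat.Coprime (p ^ k) (P : Subgroup G).index :=
    ((Nat.Prime.coprime_iff_not_dvd hp).2 P.not_dvd_index).pow_left k
  rw [← AddMonoid.addOrderOf_eq_one_iff]
  exact Nat.eq_one_of_dvd_coprimes hcop (addOrderOf_dvd_of_nsmul_eq_zero hk')
    (addOrderOf_dvd_of_nsmul_eq_zero hi)
end
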